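/- arXiv:2002.07998 — 7 statements merged into one kernel-verified Lean document; each statement's English description precedes it below -/
import Mathlib

section
/- Let k ≥ 2 be an integer, let m = k(k+1) − 1, and let n be any positive integer. Then the complete bipartite graph K_{m,n} is star-forest k-choosable: for every list assignment L assigning to each vertex v a set L(v) of at least k colours, there exists a colouring φ with φ(v) ∈ L(v) for every vertex v such that, for each colour c, the subgraph of K_{m,n} induced on φ^{-1}(c) is a star forest. -/
/-- A graph is a *star forest* if it is acyclic and no two adjacent vertices
both have degree at least `2` (i.e. both have two distinct neighbours). -/
def SimpleGraph.IsStarForest {V : Type*} (G : SimpleGraph V) : Prop :=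
  G.IsAcyclic ∧ ∀ u v : V, G.Adj u v →
    ¬ ((∃ a b : V, a ≠ b ∧ G.Adj u a ∧ G.Adj u b) ∧
       (∃ a b : V, a ≠ b ∧ G.Adj v a ∧ G.Adj v b))

/-- A graph is a *linear forest* if it is acyclic and has maximum degree at most `2`. -/
def SimpleGraph.IsLinearForest {V : Type*} (G : SimpleGraph V) : Prop :=
  G.IsAcyclic ∧ ∀ v a b c : V, G.Adj v a → G.Adj v b → G.Adj v c →
    a = b ∨ a = c ∨ b = c

/-- A graph all of whose edges meet a set with at most one vertex is a star forest. -/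
theorem SimpleGraph.isStarForest_of_subsingleton_cover {V : Type*} {G : SimpleGraph V}
    {s : Set V} (hs : s.Subsingleton) (h : ∀ u v, G.Adj u v → u ∈ s ∨ v ∈ s) :
    G.IsStarForest := by
  have leaf : ∀ u v w, G.Adj u v → u ∈ s → G.Adj v w → w = u := by
    intro u v w huv hu hvw
    rcases h v w hvw with hv | hw
    · exact absurd (hs hu hv) huv.ne
    · exact hs hw hu
  have bridge : ∀ u v, G.Adj u v → u ∈ s → G.IsBridge s(v, u) := by
    intro u v huv hu
    rw [SimpleGraph.isBridge_iff]
    rintro ⟨p⟩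
    cases p with
    | nil => exact huv.ne rfl
    | cons hadj _ =>
      rw [SimpleGraph.deleteEdges_adj] at hadj
      obtain rfl := leaf u v _ huv hu hadj.1
      exact hadj.2 rfl
  refine ⟨SimpleGraph.isAcyclic_iff_forall_adj_isBridge.2 fun u v huv => ?_, ?_⟩
  · rcases h u v huv with hu | hv
    · rw [Sym2.eq_swap]
      exact bridge u v huv hu
    · exact bridge v u huv.symm hv
  · rintro u v huv ⟨⟨a, b, hab, hua, hub⟩, ⟨c, d, hcd, hvc, hvd⟩⟩
    rcases h u v huv with hu | hv
    · exact hcd ((leaf u v c huv hu hvc).trans (leaf u v d huv hu hvd).symm)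
    · exact hab ((leaf v u a huv.symm hv hua).trans (leaf v u b huv.symm hv hub).symm)

/-- A finite family of sets of size at least `k` in which every element lies in at most `k`
members has a system of distinct representatives. -/
theorem Finset.exists_injective_mem_of_card_filter_le {ι α : Type*} [Fintype ι] [DecidableEq α]
    {k : ℕ} (hk : 0 < k) (L : ι → Finset α) (hL : ∀ i, k ≤ (L i).card)
    (hdeg : ∀ c, ({i | c ∈ L i} : Finset ι).card ≤ k) :
    ∃ f : ι → α, Function.Injective f ∧ ∀ i, f i ∈ L i := by
  rw [← Finset.all_card_le_biUnion_card_iff_exists_injective]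
  intro T
  have hcount := Finset.card_mul_le_card_mul (s := T) (t := T.biUnion L) (m := k) (n := k)
    (fun i c => c ∈ L i)
    (fun i hi => (hL i).trans <| Finset.card_le_card fun c hc =>
      (Finset.mem_bipartiteAbove _).2 ⟨Finset.mem_biUnion.2 ⟨i, hi, hc⟩, hc⟩)
    (fun c _ => (Finset.card_le_card (Finset.filter_subset_filter _ (Finset.subset_univ T))).trans
      (hdeg c))
  exact Nat.le_of_mul_le_mul_right hcount hk

/-- Among at most `j * (k + 1) + k` finite sets, some `j` elements hit enough of them that every
element lies in at most `k` of the remaining sets. -/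
theorem Finset.exists_card_le_forall_card_filter_disjoint_le {ι α : Type*} [DecidableEq α]
    (k : ℕ) (L : ι → Finset α) (j : ℕ) (T : Finset ι) (hT : T.card ≤ j * (k + 1) + k) :
    ∃ S : Finset α, S.card ≤ j ∧
      ∀ c, (T.filter fun i => Disjoint S (L i) ∧ c ∈ L i).card ≤ k := by
  induction j generalizing T with
  | zero => exact ⟨∅, by simp, fun c => (Finset.card_filter_le _ _).trans (by simpa using hT)⟩
  | succ j ih =>
    by_cases hdeg : ∀ c, (T.filter fun i => c ∈ L i).card ≤ k
    · exact ⟨∅, by simp, by simpa using hdeg⟩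
    push Not at hdeg
    obtain ⟨c, hc⟩ := hdeg
    have hsplit := Finset.card_filter_add_card_filter_not (s := T) (fun i => c ∈ L i)
    obtain ⟨S, hS, hdegS⟩ := ih (T.filter fun i => c ∉ L i) (by
      rw [Nat.succ_mul] at hT
      omega)
    refine ⟨insert c S, (Finset.card_insert_le c S).trans (by omega), fun d => ?_⟩
    simpa only [Finset.filter_filter, Finset.disjoint_insert_left, and_assoc] using hdegS d

/-- For `k ≥ 2`, `m = k(k+1) - 1` and any `n ≥ 1`, the complete
bipartite graph `K_{m,n}` is star-forest `k`-choosable. -/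
theorem starForest_choosable_completeBipartite (k n : ℕ) (hk : 2 ≤ k) (hn : 1 ≤ n)
    (L : (Fin (k * (k + 1) - 1) ⊕ Fin n) → Finset ℕ)
    (hL : ∀ v, k ≤ (L v).card) :
    ∃ φ : (Fin (k * (k + 1) - 1) ⊕ Fin n) → ℕ,
      (∀ v, φ v ∈ L v) ∧
      ∀ c : ℕ,
        ((completeBipartiteGraph (Fin (k * (k + 1) - 1)) (Fin n)).induce
          {v | φ v = c}).IsStarForest := by
  classical
  have hk0 : 0 < k := by omega
  let A (i : Fin (k * (k + 1) - 1)) : Finset ℕ := L (Sum.inl i)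
  obtain ⟨S, hS, hdeg⟩ := Finset.exists_card_le_forall_card_filter_disjoint_le k A (k - 1)
    Finset.univ (by
      obtain ⟨j, rfl⟩ := Nat.exists_eq_add_of_lt hk0
      rw [Finset.card_univ, Fintype.card_fin]
      simp only [zero_add, Nat.add_sub_cancel]
      rw [tsub_le_iff_right]
      apply le_of_eq
      ring)
  obtain ⟨f, hf_inj, hf⟩ := Finset.exists_injective_mem_of_card_filter_le hk0
    (fun i : {i // Disjoint S (A i)} => A i) (fun i => hL _) (fun c => by
      refine le_trans ?_ (hdeg c)
      rw [← Finset.card_map (Function.Embedding.subtype _)]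
      refine Finset.card_le_card fun i hi => ?_
      simp only [Finset.mem_map, Finset.mem_filter, Finset.mem_univ, true_and,
        Function.Embedding.subtype_apply] at hi ⊢
      obtain ⟨a, ha, rfl⟩ := hi
      exact ⟨a.2, ha⟩)
  have hhit : ∀ i, ¬ Disjoint S (A i) → ∃ c ∈ A i, c ∈ S := fun i hi => by
    obtain ⟨c, hcS, hcA⟩ := Finset.not_disjoint_iff.1 hi
    exact ⟨c, hcA, hcS⟩
  choose g hgA hgS using hhit
  have havoid : ∀ b : Fin n, ∃ c ∈ L (Sum.inr b), c ∉ S := fun b =>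
    Finset.exists_mem_notMem_of_card_lt_card (by have := hL (Sum.inr b); omega)
  choose h hhL hhS using havoid
  refine ⟨Sum.elim (fun i => if hi : Disjoint S (A i) then f ⟨i, hi⟩ else g i hi) h, ?_, ?_⟩
  · rintro (i | b)
    · simp only [Sum.elim_inl]
      split_ifs with hi
      · exact hf ⟨i, hi⟩
      · exact hgA i hi
    · exact hhL b
  · intro c
    apply SimpleGraph.isStarForest_of_subsingleton_cover
      (s := {v | c ∉ S ∧ v.1.isLeft})
    · rintro ⟨i | b, hi⟩ ⟨hc, hl⟩ ⟨i' | b', hi'⟩ ⟨-, hl'⟩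
      · simp only [Set.mem_ofPred_eq, Sum.elim_inl] at hi hi'
        have hd : Disjoint S (A i) := by
          by_contra hd
          rw [dif_neg hd] at hi
          exact hc (hi ▸ hgS i hd)
        have hd' : Disjoint S (A i') := by
          by_contra hd'
          rw [dif_neg hd'] at hi'
          exact hc (hi' ▸ hgS i' hd')
        rw [dif_pos hd] at hi
        rw [dif_pos hd'] at hi'
        obtain rfl : i = i' := congrArg Subtype.val (hf_inj (hi.trans hi'.symm))
        rfl
      · simp at hl'
      · simp at hl
      · simp at hl
    · rintro ⟨i | b, hi⟩ ⟨i' | b', hi'⟩ hadj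
      · simp at hadj
      · exact Or.inl ⟨hi' ▸ hhS b', rfl⟩
      · exact Or.inr ⟨hi ▸ hhS b, rfl⟩
      · simp at hadj
end

section
/- Let d ≥ 0 and m ≥ 1 be integers and let n ≥ (dm+1)·m^m. Then K_{m,n} is not (D_d)-m-choosable: there exists a list assignment L of K_{m,n} with |L(v)| = m for every vertex v such that for every colouring φ with φ(v) ∈ L(v) for all v, some vertex v has more than d neighbours u with φ(u) = φ(v). -/
/-- For `d ≥ 0`, `m ≥ 1` and `n ≥ (dm+1)·m^m`, the graph `K_{m,n}`
is not `D_d`-`m`-choosable. -/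
theorem not_defective_choosable_completeBipartite (d m n : ℕ) (hm : 1 ≤ m)
    (hn : (d * m + 1) * m ^ m ≤ n) :
    ∃ L : (Fin m ⊕ Fin n) → Finset ℕ,
      (∀ v, (L v).card = m) ∧
      ∀ φ : (Fin m ⊕ Fin n) → ℕ, (∀ v, φ v ∈ L v) →
        ∃ v, d <
          {u | (completeBipartiteGraph (Fin m) (Fin n)).Adj v u ∧ φ u = φ v}.ncard := by
  have hN : 0 < m ^ m := pow_pos hm m
  have e : Fin (m ^ m) ≃ (Fin m → Fin m) := finFunctionFinEquiv.symm
  let g : Fin n → (Fin m → Fin m) := fun j => e ⟨j % m ^ m, Nat.mod_lt _ hN⟩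
  refine ⟨Sum.elim (fun i => Finset.univ.image fun j : Fin m => Nat.pair i j)
    (fun j => Finset.univ.image fun i : Fin m => Nat.pair i (g j i)), ?_, fun φ hφ => ?_⟩
  · rintro (i | j)
    · refine (Finset.card_image_of_injective _ fun a b h => ?_).trans (Finset.card_fin m)
      exact Fin.ext (Nat.pair_eq_pair.1 h).2
    · refine (Finset.card_image_of_injective _ fun a b h => ?_).trans (Finset.card_fin m)
      exact Fin.ext (Nat.pair_eq_pair.1 h).1
  · have hl : ∀ i : Fin m, ∃ j : Fin m, Nat.pair i j = φ (Sum.inl i) := fun i => by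
      simpa using hφ (Sum.inl i)
    have hr : ∀ j : Fin n, ∃ i : Fin m, Nat.pair i (g j i) = φ (Sum.inr j) := fun j => by
      simpa using hφ (Sum.inr j)
    choose f hf using hl
    choose c hc using hr
    have hlt : ∀ k : Fin (d * m + 1), (e.symm f : ℕ) + m ^ m * k < n := fun k => by
      have h₁ := (e.symm f).isLt
      have h₂ : m ^ m * ((k : ℕ) + 1) ≤ m ^ m * (d * m + 1) := Nat.mul_le_mul_left _ k.isLt
      rw [mul_add_one] at h₂
      rw [mul_comm] at hn
      omega
    -- `d * m + 1` right vertices whose lists are exactly the colours used on the left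
    let v : Fin (d * m + 1) → Fin n := fun k => ⟨(e.symm f : ℕ) + m ^ m * k, hlt k⟩
    have hv : Function.Injective v := fun a b h => by
      have h' : m ^ m * (a : ℕ) = m ^ m * b := Nat.add_left_cancel (congrArg Fin.val h)
      exact Fin.ext (Nat.eq_of_mul_eq_mul_left hN h')
    have hg : ∀ k, g (v k) = f := fun k => by
      simp only [g, v, Nat.add_mul_mod_self_left, Nat.mod_eq_of_lt (e.symm f).isLt,
        Fin.eta, Equiv.apply_symm_apply]
    obtain ⟨i, hi⟩ := Fintype.exists_lt_card_fiber_of_mul_lt_card (fun k => c (v k)) (n := d)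
      (by simp only [Fintype.card_fin]; rw [mul_comm m d]; exact Nat.lt_succ_self _)
    refine ⟨Sum.inl i, hi.trans_le ?_⟩
    rw [← Set.ncard_coe_finset]
    refine Set.ncard_le_ncard_of_injOn (fun k => Sum.inr (v k)) (fun k hk => ?_)
      (fun a _ b _ h => hv (Sum.inr_injective h)) (Set.toFinite _)
    have hk' : c (v k) = i := by simpa using hk
    refine ⟨by simp, ?_⟩
    rw [← hc, ← hf, hg, hk']
end

section
/- For all integers k ≥ 2 and d ≥ 0, there exists a finite simple graph G such that: (i) for every list assignment L with |L(v)| ≥ k for all v, G has an L-colouring in which every colour class induces a star forest; (ii) there exists a list assignment L with |L(v)| = k(k+1) − 1 for all v such that for every L-colouring φ of G some vertex has more than d neighbours of its own colour; and (iii) for every list assignment L with |L(v)| ≥ k(k+1) for all v, G has an L-colouring in which every vertex has at most d neighbours of its own colour. In other words, ch_S(G) ≤ k and ch_{D_d}(G) = k(k+1). -/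
namespace SimpleGraph

variable {V W : Type*} {G : SimpleGraph V} {H : SimpleGraph W}

theorem IsStarForest.comap (f : G →g H) (hf : Function.Injective f) (hH : H.IsStarForest) :
    G.IsStarForest := by
  refine ⟨hH.1.comap f hf, ?_⟩
  rintro u v huv ⟨⟨a, b, hab, ha, hb⟩, ⟨a', b', hab', ha', hb'⟩⟩
  exact hH.2 (f u) (f v) (f.map_adj huv)
    ⟨⟨f a, f b, hf.ne hab, f.map_adj ha, f.map_adj hb⟩,
      ⟨f a', f b', hf.ne hab', f.map_adj ha', f.map_adj hb'⟩⟩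

theorem isStarForest_starGraph (r : V) : (starGraph r).IsStarForest := by
  refine ⟨isAcyclic_starGraph r, ?_⟩
  simp only [starGraph_adj]
  grind

theorem isStarForest_of_forall_adj (r : V) (h : ∀ u v, G.Adj u v → u = r ∨ v = r) :
    G.IsStarForest :=
  (isStarForest_starGraph r).comap
    (Hom.ofLE fun u v huv => starGraph_adj.2 ⟨huv.ne, h u v huv⟩) fun _ _ h => h

theorem isStarForest_of_forall_not_adj (h : ∀ u v, ¬ G.Adj u v) : G.IsStarForest := by
  obtain rfl : G = ⊥ := by ext u v; simp [h]
  exact ⟨isAcyclic_bot, by simp⟩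

end SimpleGraph

open Finset in
/-- If no element belongs to more than `k` members of a family of sets of size at least `k`, then
the family has a system of distinct representatives. -/
theorem exists_injOn_of_card_filter_mem_le {ι α : Type*} [DecidableEq α] [Nonempty α] {k : ℕ} (hk : 0 < k)
    (s : Finset ι) (L : ι → Finset α) (hL : ∀ i ∈ s, k ≤ #(L i))
    (hdeg : ∀ c, #{i ∈ s | c ∈ L i} ≤ k) :
    ∃ f : ι → α, Set.InjOn f s ∧ ∀ i ∈ s, f i ∈ L i := by
  classical
  have hall : ∀ A : Finset s, #A ≤ #(A.biUnion fun i => L i) := by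
    intro A
    refine Nat.le_of_mul_le_mul_right
      (card_mul_le_card_mul (fun (i : s) c => c ∈ L i) (m := k) (n := k) ?_ ?_) hk
    · intro i hi
      refine (hL i i.2).trans (card_le_card fun c hc => ?_)
      simp only [mem_bipartiteAbove, mem_biUnion]
      exact ⟨⟨i, hi, hc⟩, hc⟩
    · intro c _
      refine le_trans ?_ (hdeg c)
      rw [← card_map (Function.Embedding.subtype (· ∈ s))]
      refine card_le_card fun i hi => ?_
      obtain ⟨j, hj, rfl⟩ := mem_map.1 hi
      exact mem_filter.2 ⟨j.2, ((mem_bipartiteBelow _).1 hj).2⟩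
  obtain ⟨f, hf, hfL⟩ := (all_card_le_biUnion_card_iff_exists_injective _).1 hall
  refine ⟨fun i => if h : i ∈ s then f ⟨i, h⟩ else Classical.arbitrary α, ?_, ?_⟩
  · intro i hi j hj hij
    simp only [mem_coe] at hi hj
    simp only [hi, hj, dif_pos] at hij
    exact congrArg Subtype.val (hf hij)
  · intro i hi
    simpa only [hi, dif_pos] using hfL ⟨i, hi⟩

open Finset in
/-- Fewer than `(t + 1) * (k + 1)` sets of size at least `k` have representatives of which at
most `t` are used more than once. -/
theorem exists_representatives_of_card_lt {ι α : Type*} [DecidableEq α] [Nonempty α] {k : ℕ} (hk : 0 < k)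
    (t : ℕ) (s : Finset ι) (L : ι → Finset α) (hL : ∀ i ∈ s, k ≤ #(L i))
    (hs : #s < (t + 1) * (k + 1)) :
    ∃ S : Finset α, #S ≤ t ∧ ∃ f : ι → α, (∀ i ∈ s, f i ∈ L i) ∧
      ∀ i ∈ s, ∀ j ∈ s, f i = f j → f i ∉ S → i = j := by
  classical
  induction t generalizing s with
  | zero =>
    obtain ⟨f, hf, hfL⟩ := exists_injOn_of_card_filter_mem_le hk s L hL
      fun c => (card_filter_le _ _).trans (by lia)
    exact ⟨∅, by simp, f, hfL, fun i hi j hj hij _ => hf hi hj hij⟩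
  | succ t ih =>
    by_cases h : ∀ c, #{i ∈ s | c ∈ L i} ≤ k
    · obtain ⟨f, hf, hfL⟩ := exists_injOn_of_card_filter_mem_le hk s L hL h
      exact ⟨∅, by simp, f, hfL, fun i hi j hj hij _ => hf hi hj hij⟩
    · push Not at h
      obtain ⟨c, hc⟩ := h
      have hsplit := card_filter_add_card_filter_not (s := s) (fun i => c ∈ L i)
      obtain ⟨S, hS, f, hfL, hf⟩ := ih {i ∈ s | c ∉ L i}
        (fun i hi => hL i (mem_filter.1 hi).1) (by lia)
      refine ⟨insert c S, (card_insert_le _ _).trans (by lia),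
        fun i => if c ∈ L i then c else f i, ?_, ?_⟩
      · intro i hi
        by_cases hci : c ∈ L i
        · simp [hci]
        · simpa [hci] using hfL i (mem_filter.2 ⟨hi, hci⟩)
      · intro i hi j hj hij hiS
        have := hf i
        have := hf j
        grind

open SimpleGraph

theorem exists_starForest_colouring_completeBipartiteGraph {α β : Type*} [Fintype α] {k : ℕ}
    (hk : 0 < k) (hα : Fintype.card α < k * (k + 1)) (L : α ⊕ β → Finset ℕ)
    (hL : ∀ v, k ≤ (L v).card) :
    ∃ φ : α ⊕ β → ℕ, (∀ v, φ v ∈ L v) ∧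
      ∀ c, ((completeBipartiteGraph α β).induce {v | φ v = c}).IsStarForest := by
  obtain ⟨t, rfl⟩ : ∃ t, k = t + 1 := ⟨k - 1, by lia⟩
  obtain ⟨S, hS, f, hfL, hf⟩ := exists_representatives_of_card_lt hk t Finset.univ
    (fun a : α => L (.inl a)) (fun a _ => hL _) hα
  have hg (b : β) : ∃ c ∈ L (.inr b), c ∉ S :=
    Finset.exists_mem_notMem_of_card_lt_card (by have := hL (.inr b); lia)
  choose g hgL hgS using hg
  refine ⟨Sum.elim f g, ?_, fun c => ?_⟩
  · rintro (a | b)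
    exacts [hfL a (Finset.mem_univ a), hgL b]
  by_cases h : ∃ a, f a = c ∧ c ∉ S
  · obtain ⟨a, rfl, haS⟩ := h
    have key (a' : α) (h : f a' = f a) : a' = a :=
      (hf a (Finset.mem_univ a) a' (Finset.mem_univ a') h.symm haS).symm
    refine isStarForest_of_forall_adj ⟨.inl a, rfl⟩ ?_
    rintro ⟨u | u, hu⟩ ⟨v | v, hv⟩ huv
    · simp at huv
    · exact .inl (Subtype.ext (congrArg Sum.inl (key u hu)))
    · exact .inr (Subtype.ext (congrArg Sum.inl (key v hv)))
    · simp at huv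
  · push Not at h
    refine isStarForest_of_forall_not_adj ?_
    rintro ⟨u | u, hu⟩ ⟨v | v, hv⟩ huv
    · simp at huv
    · exact hgS v ((show g v = c from hv) ▸ h u hu)
    · exact hgS u ((show g u = c from hu) ▸ h v hv)
    · simp at huv

theorem exists_lists_completeBipartiteGraph_not_defective (m d : ℕ) :
    ∃ L : Fin m ⊕ ((Fin m → Fin m) × Fin (m * d + 1)) → Finset ℕ, (∀ v, (L v).card = m) ∧
      ∀ φ : Fin m ⊕ ((Fin m → Fin m) × Fin (m * d + 1)) → ℕ, (∀ v, φ v ∈ L v) →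
        ∃ v, d < {u | (completeBipartiteGraph _ _).Adj v u ∧ φ u = φ v}.ncard := by
  let colour : Fin m × Fin m → ℕ := fun p => finProdFinEquiv p
  have hcolour : Function.Injective colour :=
    Fin.val_injective.comp finProdFinEquiv.injective
  refine ⟨Sum.elim (fun i => Finset.univ.image fun j => colour (i, j))
    (fun b => Finset.univ.image fun i => colour (i, b.1 i)), ?_, fun φ hφ => ?_⟩
  · rintro (i | b)
    · simpa using Finset.card_image_of_injective (Finset.univ : Finset (Fin m))
        fun j j' h => (Prod.ext_iff.1 (hcolour h)).2
    · simpa using Finset.card_image_of_injective (Finset.univ : Finset (Fin m))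
        fun i i' (h : colour (i, b.1 i) = colour (i', b.1 i')) => (Prod.ext_iff.1 (hcolour h)).1
  have hleft (i : Fin m) : ∃ j, colour (i, j) = φ (.inl i) := by simpa using hφ (.inl i)
  choose g hg using hleft
  have hright (x : Fin (m * d + 1)) : ∃ i, φ (.inl i) = φ (.inr (g, x)) := by
    simpa [hg] using hφ (.inr (g, x))
  choose f hf using hright
  obtain ⟨i, hi⟩ := Fintype.exists_lt_card_fiber_of_mul_lt_card f (n := d) (by simp)
  refine ⟨.inl i, hi.trans_le ?_⟩
  rw [← Set.ncard_coe_finset, ← Set.ncard_image_of_injective (f := fun x => Sum.inr (g, x)) _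
    (fun x y h => (Prod.ext_iff.1 (Sum.inr_injective h)).2)]
  refine Set.ncard_le_ncard ?_ (Set.toFinite _)
  rintro _ ⟨x, hx, rfl⟩
  obtain rfl : f x = i := by simpa using hx
  exact ⟨by simp, (hf x).symm⟩

theorem exists_proper_colouring_completeBipartiteGraph {α β : Type*} [Fintype α]
    (L : α ⊕ β → Finset ℕ) (hL : ∀ v, Fintype.card α < (L v).card) :
    ∃ φ : α ⊕ β → ℕ, (∀ v, φ v ∈ L v) ∧
      ∀ u v, (completeBipartiteGraph α β).Adj u v → φ u ≠ φ v := by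
  have hf (a : α) : (L (.inl a)).Nonempty :=
    Finset.card_pos.1 ((Nat.zero_le _).trans_lt (hL _))
  choose f hfL using hf
  have hg (b : β) : ∃ c ∈ L (.inr b), c ∉ Finset.univ.image f :=
    Finset.exists_mem_notMem_of_card_lt_card (Finset.card_image_le.trans_lt (hL _))
  choose g hgL hgf using hg
  have hfg (a : α) (b : β) : f a ≠ g b := fun h =>
    hgf b (Finset.mem_image.2 ⟨a, Finset.mem_univ a, h⟩)
  refine ⟨Sum.elim f g, ?_, ?_⟩
  · rintro (a | b)
    exacts [hfL a, hgL b]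
  · rintro (u | u) (v | v) huv
    · simp at huv
    · exact hfg u v
    · exact (hfg v u).symm
    · simp at huv

/-- For all `k ≥ 2` and `d ≥ 0` there is a finite graph `G` with
`ch_S(G) ≤ k` and `ch_{D_d}(G) = k(k+1)`. -/
theorem exists_graph_starChoosable_not_defectiveChoosable (k d : ℕ) (hk : 2 ≤ k) :
    ∃ (N : ℕ) (G : SimpleGraph (Fin N)),
      (∀ L : Fin N → Finset ℕ, (∀ v, k ≤ (L v).card) →
        ∃ φ : Fin N → ℕ, (∀ v, φ v ∈ L v) ∧
          ∀ c : ℕ, (G.induce {v | φ v = c}).IsStarForest) ∧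
      (∃ L : Fin N → Finset ℕ, (∀ v, (L v).card = k * (k + 1) - 1) ∧
        ∀ φ : Fin N → ℕ, (∀ v, φ v ∈ L v) →
          ∃ v, d < {u | G.Adj v u ∧ φ u = φ v}.ncard) ∧
      (∀ L : Fin N → Finset ℕ, (∀ v, k * (k + 1) ≤ (L v).card) →
        ∃ φ : Fin N → ℕ, (∀ v, φ v ∈ L v) ∧
          ∀ v, {u | G.Adj v u ∧ φ u = φ v}.ncard ≤ d) := by
  let m := k * (k + 1) - 1
  have hm : m + 1 = k * (k + 1) := Nat.sub_add_cancel (Nat.mul_pos (by lia) (by lia))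
  let β := (Fin m → Fin m) × Fin (m * d + 1)
  let e := (Fintype.equivFin (Fin m ⊕ β)).symm
  refine ⟨_, (completeBipartiteGraph (Fin m) β).comap e, fun L hL => ?_, ?_, fun L hL => ?_⟩
  · obtain ⟨φ, hφL, hφ⟩ := exists_starForest_colouring_completeBipartiteGraph
      (α := Fin m) (β := β) (by lia) (by rw [Fintype.card_fin]; lia) (L ∘ e.symm) fun v => hL _
    refine ⟨φ ∘ e, fun v => by simpa using hφL (e v), fun c => ?_⟩
    exact (hφ c).comap ⟨fun v => ⟨e v, v.2⟩, fun h => h⟩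
      fun u v h => Subtype.ext (e.injective (congrArg Subtype.val h))
  · obtain ⟨L, hL, h⟩ := exists_lists_completeBipartiteGraph_not_defective m d
    refine ⟨L ∘ e, fun v => hL _, fun φ hφ => ?_⟩
    obtain ⟨v, hv⟩ := h (φ ∘ e.symm) fun v => by simpa using hφ (e.symm v)
    refine ⟨e.symm v, hv.trans_le ?_⟩
    rw [← Set.ncard_image_of_injective _ e.symm.injective]
    refine Set.ncard_le_ncard ?_ (Set.toFinite _)
    rintro _ ⟨u, ⟨huv, hu⟩, rfl⟩
    exact ⟨by simpa only [comap_adj, Equiv.apply_symm_apply] using huv, hu⟩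
  · obtain ⟨φ, hφL, hφ⟩ := exists_proper_colouring_completeBipartiteGraph
      (α := Fin m) (β := β) (L ∘ e.symm)
      fun v => by rw [Fintype.card_fin]; have := hL (e.symm v); simp only [Function.comp]; lia
    refine ⟨φ ∘ e, fun v => by simpa using hφL (e v), fun v => ?_⟩
    have hempty : {u | ((completeBipartiteGraph (Fin m) β).comap e).Adj v u ∧
        (φ ∘ e) u = (φ ∘ e) v} = ∅ :=
      Set.eq_empty_of_forall_notMem fun u hu => hφ _ _ hu.1 hu.2.symm
    rw [hempty, Set.ncard_empty]
    exact Nat.zero_le d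
end

section
/- For every positive integer p there exist a finite simple graph G and an integer k ≥ 2 such that: (i) for every list assignment L of G with |L(v)| ≥ k for all v, G has an L-colouring in which every colour class induces a star forest; and (ii) there exists a list assignment L of G with |L(v)| = p·k for all v such that G has no proper L-colouring. In particular, ch(G) ≥ p·ch_S(G), so the choice number is not bounded by any linear function of the star-forest choice number. -/
/-- A graph all of whose edges join the at most one vertex of `P` to a vertex outside `P`
is a star forest. -/
theorem SimpleGraph.isStarForest_of_subsingleton {V : Type*} (H : SimpleGraph V) (P : V → Prop)
    (hP : ∀ u v, P u → P v → u = v) (hH : ∀ u v, H.Adj u v → ¬ (P u ↔ P v)) :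
    H.IsStarForest := by
  have leaf : ∀ u v, H.Adj u v → ¬ P u → ∀ a b, H.Adj u a → H.Adj u b → a = b := by
    intro u v _ hu a b ha hb
    have h1 := hH u a ha
    have h2 := hH u b hb
    exact hP a b (by tauto) (by tauto)
  refine ⟨?_, ?_⟩
  · rw [SimpleGraph.isAcyclic_iff_forall_adj_isBridge]
    have bridge : ∀ u v, H.Adj u v → ¬ P u → H.IsBridge s(u, v) := by
      intro u v huv hu
      rw [SimpleGraph.isBridge_iff]
      rintro ⟨w⟩
      cases w with
      | nil => exact H.irrefl huv
      | cons h _ =>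
        rw [SimpleGraph.deleteEdges_adj] at h
        exact h.2 (by rw [leaf u v huv hu _ v h.1 huv]; rfl)
    intro u v huv
    by_cases hu : P u
    · have hv : ¬ P v := fun hv => hH u v huv (by tauto)
      rw [Sym2.eq_swap]
      exact bridge v u huv.symm hv
    · exact bridge u v huv hu
  · rintro u v huv ⟨⟨a, b, hab, ha, hb⟩, ⟨c, d, hcd, hc, hd⟩⟩
    by_cases hu : P u
    · have hv : ¬ P v := fun hv => hH u v huv (by tauto)
      exact hcd (leaf v u huv.symm hv c d hc hd)
    · exact hab (leaf u v huv hu a b ha hb)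

/-- If every vertex of `S` has at least `k` colours and every colour lies in at most `k` of the
lists, then the lists have a system of distinct representatives. -/
theorem exists_injOn_mem_of_card_filter_le {V : Type*} (k : ℕ) (hk : 0 < k) (S : Finset V)
    (L : V → Finset ℕ) (hL : ∀ v ∈ S, k ≤ (L v).card)
    (hdeg : ∀ c, (S.filter fun v => c ∈ L v).card ≤ k) :
    ∃ φ : V → ℕ, (∀ v ∈ S, φ v ∈ L v) ∧ Set.InjOn φ S := by
  classical
  have hall : ∀ s : Finset S, s.card ≤ (s.biUnion fun v => L v).card := by
    intro s
    refine Nat.le_of_mul_le_mul_right (c := k) ?_ hk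
    refine Finset.card_mul_le_card_mul (fun (v : S) c => c ∈ L v) ?_ ?_
    · intro v hv
      refine (hL v v.2).trans (Finset.card_le_card fun c hc => ?_)
      simp only [Finset.bipartiteAbove, Finset.mem_filter, Finset.mem_biUnion]
      exact ⟨⟨v, hv, hc⟩, hc⟩
    · intro c _
      refine le_trans ?_ (hdeg c)
      refine Finset.card_le_card_of_injOn (fun v : S => (v : V)) ?_ Subtype.val_injective.injOn
      intro v hv
      simp only [Finset.bipartiteBelow, Finset.coe_filter, Set.mem_ofPred_eq] at hv
      simpa using hv.2
  obtain ⟨f, hf, hfL⟩ :=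
    (Finset.all_card_le_biUnion_card_iff_exists_injective fun v : S => L v).1 hall
  refine ⟨fun v => if h : v ∈ S then f ⟨v, h⟩ else 0, ?_, ?_⟩
  · intro v hv
    simpa [hv] using hfL ⟨v, hv⟩
  · intro u hu v hv huv
    have hu' : u ∈ S := hu
    have hv' : v ∈ S := hv
    simp only [hu', hv', dif_pos] at huv
    exact congrArg Subtype.val (hf huv)

/-- From lists of size at least `k` one can colour `S` so that at most `|S| / (k + 1)` colours
are used more than once. -/
theorem exists_coloring_few_repeated {V : Type*} (k : ℕ) (hk : 0 < k) (L : V → Finset ℕ)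
    (S : Finset V) (hL : ∀ v ∈ S, k ≤ (L v).card) :
    ∃ (R : Finset ℕ) (φ : V → ℕ), R.card * (k + 1) ≤ S.card ∧ (∀ v ∈ S, φ v ∈ L v) ∧
      ∀ u ∈ S, ∀ v ∈ S, φ u = φ v → φ u ∉ R → u = v := by
  classical
  induction S using Finset.strongInduction with
  | H S ih =>
    by_cases h : ∃ c, k < (S.filter fun v => c ∈ L v).card
    · obtain ⟨c, hc⟩ := h
      have hsum := S.card_filter_add_card_filter_not (fun v => c ∈ L v)
      have hss : S.filter (fun v => c ∉ L v) ⊂ S := by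
        refine Finset.filter_ssubset.2 ?_
        obtain ⟨v, hv⟩ := Finset.card_pos.1 (hk.trans hc)
        rw [Finset.mem_filter] at hv
        exact ⟨v, hv.1, not_not.2 hv.2⟩
      obtain ⟨R, φ, hR, hφ, hinj⟩ := ih _ hss fun v hv => hL v (Finset.mem_filter.1 hv).1
      refine ⟨insert c R, fun v => if c ∈ L v then c else φ v, ?_, ?_, ?_⟩
      · have h1 := Nat.mul_le_mul_right (k + 1) (Finset.card_insert_le c R)
        rw [Nat.succ_mul] at h1
        omega
      · intro v hv
        by_cases hcv : c ∈ L v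
        · simp [hcv]
        · simpa [hcv] using hφ v (Finset.mem_filter.2 ⟨hv, hcv⟩)
      · intro u hu v hv huv hnot
        by_cases hcu : c ∈ L u
        · simp [hcu] at hnot
        · by_cases hcv : c ∈ L v
          · simp [hcu, hcv] at huv hnot
            exact absurd huv hnot.1
          · simp only [hcu, hcv, if_false, Finset.mem_insert, not_or] at huv hnot
            exact hinj u (Finset.mem_filter.2 ⟨hu, hcu⟩) v (Finset.mem_filter.2 ⟨hv, hcv⟩)
              huv hnot.2
    · push Not at h
      obtain ⟨φ, hφ, hinj⟩ := exists_injOn_mem_of_card_filter_le k hk S L hL h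
      exact ⟨∅, φ, by simp, hφ, fun u hu v hv huv _ => hinj hu hv huv⟩

/-- A complete bipartite graph with parts `S` and its complement, where `|S| < k * (k + 1)`, is
star-forest `k`-choosable. -/
theorem exists_starForest_coloring_of_bipartite {V : Type*} (G : SimpleGraph V) (S : Finset V)
    (hG : ∀ u v, G.Adj u v → ¬ (u ∈ S ↔ v ∈ S)) (k : ℕ) (hk : 0 < k)
    (hS : S.card < k * (k + 1)) (L : V → Finset ℕ) (hL : ∀ v, k ≤ (L v).card) :
    ∃ φ : V → ℕ, (∀ v, φ v ∈ L v) ∧ ∀ c : ℕ, (G.induce {v | φ v = c}).IsStarForest := by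
  classical
  obtain ⟨R, φ, hR, hφ, hinj⟩ := exists_coloring_few_repeated k hk L S fun v _ => hL v
  have hRk : R.card < k := Nat.lt_of_mul_lt_mul_right (hR.trans_lt hS)
  have hex : ∀ v, ∃ c ∈ L v, c ∉ R := fun v =>
    Finset.exists_mem_notMem_of_card_lt_card (hRk.trans_le (hL v))
  choose g hgL hgR using hex
  refine ⟨fun v => if v ∈ S then φ v else g v, ?_, ?_⟩
  · intro v
    by_cases hv : v ∈ S
    · simpa [hv] using hφ v hv
    · simpa [hv] using hgL v
  · intro c
    by_cases hc : c ∈ R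
    · have hmem : ∀ v, (if v ∈ S then φ v else g v) = c → v ∈ S := by
        intro v hv
        by_contra hvS
        rw [if_neg hvS] at hv
        exact hgR v (hv ▸ hc)
      refine SimpleGraph.isStarForest_of_subsingleton _ (fun _ => False) (by simp) ?_
      rintro ⟨u, hu⟩ ⟨v, hv⟩ huv
      exact absurd (iff_of_true (hmem u hu) (hmem v hv)) (hG u v huv)
    · refine SimpleGraph.isStarForest_of_subsingleton _ (fun v => v.1 ∈ S) ?_ ?_
      · rintro ⟨u, hu⟩ ⟨v, hv⟩ huS hvS
        simp only at huS hvS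
        simp only [Set.mem_ofPred_eq, huS, hvS, if_true] at hu hv
        exact Subtype.ext (hinj u huS v hvS (hu.trans hv.symm) (hu ▸ hc))
      · rintro ⟨u, hu⟩ ⟨v, hv⟩ huv
        exact hG u v huv

/-- The complete bipartite graph with parts of sizes `n` and `n ^ n` is not `n`-choosable. -/
theorem exists_lists_completeBipartiteGraph_not_colorable (n : ℕ) :
    ∃ L : Fin n ⊕ (Fin n → Fin n) → Finset ℕ, (∀ v, (L v).card = n) ∧
      ∀ φ : Fin n ⊕ (Fin n → Fin n) → ℕ, (∀ v, φ v ∈ L v) →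
        ∃ i f, φ (Sum.inl i) = φ (Sum.inr f) := by
  refine ⟨Sum.elim (fun i => Finset.univ.image fun j : Fin n => Nat.pair i j)
    (fun f => Finset.univ.image fun i : Fin n => Nat.pair i (f i)), ?_, ?_⟩
  · rintro (i | f)
    · rw [Sum.elim_inl, Finset.card_image_of_injective, Finset.card_univ, Fintype.card_fin]
      intro a b hab
      exact Fin.ext (Nat.pair_eq_pair.1 hab).2
    · rw [Sum.elim_inr, Finset.card_image_of_injective, Finset.card_univ, Fintype.card_fin]
      intro a b hab
      exact Fin.ext (Nat.pair_eq_pair.1 hab).1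
  · intro φ hφ
    have h1 : ∀ i : Fin n, ∃ j : Fin n, Nat.pair i j = φ (Sum.inl i) := fun i => by
      simpa using hφ (Sum.inl i)
    choose f hf using h1
    obtain ⟨i, hi⟩ : ∃ i : Fin n, Nat.pair i (f i) = φ (Sum.inr f) := by
      simpa using hφ (Sum.inr f)
    exact ⟨i, f, (hf i).symm.trans hi⟩

/-- For every `p ≥ 1` there are a finite graph `G` and `k ≥ 2` such that
`G` is star-forest `k`-choosable, yet some `(p·k)`-list assignment of `G` admits no
proper colouring; hence `ch(G) ≥ p · ch_S(G)`. -/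
theorem exists_graph_choiceNumber_ge_mul_starChoiceNumber (p : ℕ) (hp : 1 ≤ p) :
    ∃ (N : ℕ) (G : SimpleGraph (Fin N)) (k : ℕ), 2 ≤ k ∧
      (∀ L : Fin N → Finset ℕ, (∀ v, k ≤ (L v).card) →
        ∃ φ : Fin N → ℕ, (∀ v, φ v ∈ L v) ∧
          ∀ c : ℕ, (G.induce {v | φ v = c}).IsStarForest) ∧
      (∃ L : Fin N → Finset ℕ, (∀ v, (L v).card = p * k) ∧
        ¬ ∃ φ : Fin N → ℕ, (∀ v, φ v ∈ L v) ∧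
            ∀ u v, G.Adj u v → φ u ≠ φ v) := by
  classical
  set n := p * (p + 1) with hn
  let e := Fintype.equivFin (Fin n ⊕ (Fin n → Fin n))
  refine ⟨_, (completeBipartiteGraph (Fin n) (Fin n → Fin n)).comap e.symm, p + 1, by omega,
    ?_, ?_⟩
  · refine exists_starForest_coloring_of_bipartite _
      (Finset.univ.image fun i : Fin n => e (Sum.inl i)) ?_ (p + 1) (by omega) ?_
    · intro u v huv
      obtain ⟨x, rfl⟩ := e.surjective u
      obtain ⟨y, rfl⟩ := e.surjective v
      rcases x with x | x <;> rcases y with y | y <;> simp at huv ⊢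
    · refine Finset.card_image_le.trans_lt ?_
      rw [Finset.card_univ, Fintype.card_fin]
      nlinarith
  · obtain ⟨L, hL, hno⟩ := exists_lists_completeBipartiteGraph_not_colorable n
    refine ⟨fun v => L (e.symm v), fun v => hL _, ?_⟩
    rintro ⟨φ, hφ, hproper⟩
    obtain ⟨i, f, hif⟩ := hno (fun x => φ (e x)) fun x => by simpa using hφ (e x)
    exact hproper _ _ (by simp) hif
end

section
/- For every integer k ≥ 2 there exists a finite simple graph G such that: (i) for every list assignment L with |L(v)| ≥ k for all v, G has an L-colouring in which every colour class induces a star forest; and (ii) there exists a list assignment L with |L(v)| = k(k+1) − 1 for all v such that G has no L-colouring in which every colour class induces a linear forest. In particular, ch_L(G) ≥ ch_S(G)·(ch_S(G)+1) for this G. -/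
open Finset in
/-- If every list has at least `k` colours and Hall's condition fails on `X`,
some colour lies in more than `k` lists of `X`. -/
theorem Finset.exists_lt_card_filter_mem_of_card_biUnion_lt {ι α : Type*} [DecidableEq α]
    {k : ℕ} {X : Finset ι} {L : ι → Finset α} (hk : 0 < k) (hL : ∀ x ∈ X, k ≤ #(L x))
    (hX : #(X.biUnion L) < #X) : ∃ c, k < #{x ∈ X | c ∈ L x} := by
  by_contra! h
  have hle : #X * k ≤ #(X.biUnion L) * k := by
    refine card_mul_le_card_mul (fun x c ↦ c ∈ L x) (fun x hx ↦ ?_) fun c _ ↦ h c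
    refine (hL x hx).trans (card_le_card fun c hc ↦ ?_)
    exact (mem_bipartiteAbove _).2 ⟨mem_biUnion.2 ⟨x, hx, hc⟩, hc⟩
  exact absurd (Nat.le_of_mul_le_mul_right hle hk) (by omega)

open Finset in
/-- Hall's theorem relative to a finite subset of the index type. -/
theorem Finset.exists_injOn_of_card_le_card_biUnion {ι α : Type*} [DecidableEq ι] [DecidableEq α]
    [Nonempty α] {S : Finset ι} {L : ι → Finset α} (h : ∀ X ⊆ S, #X ≤ #(X.biUnion L)) :
    ∃ φ : ι → α, (∀ x ∈ S, φ x ∈ L x) ∧ Set.InjOn φ S := by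
  obtain ⟨f, hf, hfL⟩ := (all_card_le_biUnion_card_iff_exists_injective
      (fun x : S ↦ L x)).1 fun X ↦ by
    have := h (X.map (.subtype _)) fun x hx ↦ property_of_mem_map_subtype X hx
    rw [card_map, map_eq_image, image_biUnion] at this
    exact this
  refine ⟨fun x ↦ if h : x ∈ S then f ⟨x, h⟩ else Classical.arbitrary α, fun x hx ↦ ?_,
    fun x hx y hy hxy ↦ ?_⟩
  · simpa [hx] using hfL ⟨x, hx⟩
  · simp only [mem_coe.1 hx, mem_coe.1 hy, dite_true] at hxy
    exact congrArg Subtype.val (hf hxy)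

open Finset in
/-- From lists of size at least `k` on at most `k + j(k+1)` elements one can choose colours
so that at most `j` colours are repeated. -/
theorem Finset.exists_choice_few_repeated {ι α : Type*} [DecidableEq ι] [DecidableEq α]
    [Nonempty α] {k : ℕ} (hk : 0 < k) {L : ι → Finset α} (hL : ∀ x, k ≤ #(L x)) (j : ℕ)
    (S : Finset ι) (hS : #S ≤ k + j * (k + 1)) :
    ∃ φ : ι → α, ∃ D : Finset α, (∀ x ∈ S, φ x ∈ L x) ∧ #D ≤ j ∧
      ∀ x ∈ S, ∀ y ∈ S, φ x = φ y → φ x ∉ D → x = y := by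
  induction j generalizing S with
  | zero =>
    obtain ⟨φ, hφ, hinj⟩ := exists_injOn_of_card_le_card_biUnion (S := S) (L := L) fun X hXS ↦ by
      obtain rfl | ⟨x, hx⟩ := X.eq_empty_or_nonempty
      · simp
      · have hsub := card_le_card (subset_biUnion_of_mem L hx)
        have := card_le_card hXS
        have := hL x
        omega
    exact ⟨φ, ∅, hφ, by simp, fun x hx y hy h _ ↦ hinj hx hy h⟩
  | succ j ih =>
    by_cases hHall : ∀ X ⊆ S, #X ≤ #(X.biUnion L)
    · obtain ⟨φ, hφ, hinj⟩ := exists_injOn_of_card_le_card_biUnion hHall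
      exact ⟨φ, ∅, hφ, by simp, fun x hx y hy h _ ↦ hinj hx hy h⟩
    · push Not at hHall
      obtain ⟨X, hXS, hX⟩ := hHall
      obtain ⟨c, hc⟩ := exists_lt_card_filter_mem_of_card_biUnion_lt hk (fun x _ ↦ hL x) hX
      have hle : #{x ∈ X | c ∈ L x} ≤ #{x ∈ S | c ∈ L x} :=
        card_le_card (filter_subset_filter _ hXS)
      have hadd := card_filter_add_card_filter_not (s := S) (fun x ↦ c ∈ L x)
      obtain ⟨φ, D, hφ, hD, hinj⟩ := ih {x ∈ S | c ∉ L x} (by rw [add_mul] at hS; omega)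
      refine ⟨fun x ↦ if c ∈ L x then c else φ x, insert c D, fun x hx ↦ ?_,
        (card_insert_le c D).trans (by omega), fun x hx y hy h hxD ↦ ?_⟩
      · by_cases hcx : c ∈ L x
        · simp [hcx]
        · simpa [hcx] using hφ x (by simp [hx, hcx])
      · by_cases hcx : c ∈ L x
        · simp [hcx] at hxD
        · by_cases hcy : c ∈ L y
          · simp_all
          · simp only [hcx, hcy, if_false, mem_insert, not_or] at h hxD
            exact hinj x (by simp [hx, hcx]) y (by simp [hy, hcy]) h hxD.2

/-- A bipartite graph with at most one vertex on one side is a star forest. -/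
theorem SimpleGraph.isStarForest_of_subsingleton_side {V : Type*} {G : SimpleGraph V}
    {s : Set V} (hG : ∀ u v, G.Adj u v → (u ∈ s ↔ v ∉ s)) (hs : s.Subsingleton) :
    G.IsStarForest := by
  constructor
  · obtain rfl | ⟨r, hr⟩ := s.eq_empty_or_nonempty
    · have : G = ⊥ := by
        ext u v
        simpa using hG u v
      exact this ▸ isAcyclic_bot
    · refine (isAcyclic_starGraph r).anti fun u v huv ↦ starGraph_adj.2 ⟨huv.ne, ?_⟩
      by_cases hu : u ∈ s
      · exact .inl (hs hu hr)
      · exact .inr (hs (by simpa [hu] using hG u v huv) hr)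
  · rintro u v huv ⟨⟨a, b, hab, hua, hub⟩, ⟨a', b', hab', hva, hvb⟩⟩
    by_cases hu : u ∈ s
    · have := hG u v huv
      have := hG v a' hva
      have := hG v b' hvb
      exact hab' (hs (by tauto) (by tauto))
    · have := hG u a hua
      have := hG u b hub
      exact hab (hs (by tauto) (by tauto))

open Finset in
/-- A complete bipartite graph with one side of size at most `k(k+1) - 1` is star forest
`k`-choosable. -/
theorem SimpleGraph.exists_starForest_listColoring_completeBipartiteGraph {A B : Type*}
    [Fintype A] {k : ℕ} (hk : 0 < k) (hA : Fintype.card A ≤ k * (k + 1) - 1)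
    {L : A ⊕ B → Finset ℕ} (hL : ∀ v, k ≤ #(L v)) :
    ∃ φ : A ⊕ B → ℕ, (∀ v, φ v ∈ L v) ∧
      ∀ c, ((completeBipartiteGraph A B).induce {v | φ v = c}).IsStarForest := by
  classical
  obtain ⟨j, rfl⟩ : ∃ j, k = j + 1 := ⟨k - 1, by omega⟩
  obtain ⟨φ, D, hφ, hD, hinj⟩ := exists_choice_few_repeated hk (fun a : A ↦ hL (.inl a)) j univ
    (hA.trans (by rw [add_mul]; omega))
  have hB : ∀ b : B, ∃ c ∈ L (.inr b), c ∉ D := fun b ↦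
    exists_mem_notMem_of_card_lt_card (by have := hL (.inr b); omega)
  choose ψ hψ hψD using hB
  refine ⟨Sum.elim φ ψ, ?_, fun c ↦ ?_⟩
  · rintro (a | b)
    · exact hφ a (mem_univ a)
    · exact hψ b
  · by_cases hc : c ∈ D
    · refine isStarForest_of_subsingleton_side (s := ∅) ?_ (by simp)
      rintro ⟨u | u, hu⟩ ⟨v | v, hv⟩ <;> simp
      · exact hψD v (by rwa [show ψ v = c from hv])
      · exact hψD u (by rwa [show ψ u = c from hu])
    · refine isStarForest_of_subsingleton_side (s := {v | Sum.isLeft v.1}) ?_ ?_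
      · rintro ⟨u | u, hu⟩ ⟨v | v, hv⟩ <;> simp
      · rintro ⟨u | u, hu⟩ hu' ⟨v | v, hv⟩ hv' <;> simp at hu hv hu' hv' ⊢
        exact Subtype.ext (congrArg Sum.inl
          (hinj u (mem_univ u) v (mem_univ v) (hu.trans hv.symm) (by rwa [hu])))

open Finset in
/-- If one side has `m` vertices and the other is large enough, a complete bipartite graph is
not linear forest `m`-choosable. -/
theorem SimpleGraph.exists_lists_no_linearForest_completeBipartiteGraph (m : ℕ) :
    ∃ L : Fin m ⊕ (Fin m → Fin m) × Fin (m * 2 + 1) → Finset ℕ, (∀ v, #(L v) = m) ∧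
      ¬ ∃ φ : Fin m ⊕ (Fin m → Fin m) × Fin (m * 2 + 1) → ℕ, (∀ v, φ v ∈ L v) ∧
        ∀ c, ((completeBipartiteGraph _ _).induce {v | φ v = c}).IsLinearForest := by
  let L : Fin m ⊕ (Fin m → Fin m) × Fin (m * 2 + 1) → Finset ℕ :=
    Sum.elim (fun i ↦ univ.image fun j : Fin m ↦ Nat.pair i j)
      (fun p ↦ univ.image fun i : Fin m ↦ Nat.pair i (p.1 i))
  refine ⟨L, ?_, ?_⟩
  · rintro (i | p)
    · simp only [L, Sum.elim_inl]
      rw [card_image_of_injective _ fun a b h ↦ Fin.ext (Nat.pair_eq_pair.1 h).2]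
      simp
    · simp only [L, Sum.elim_inr]
      rw [card_image_of_injective _ fun a b h ↦ Fin.ext (Nat.pair_eq_pair.1 h).1]
      simp
  · rintro ⟨φ, hφ, hlin⟩
    have hA : ∀ i : Fin m, ∃ j : Fin m, Nat.pair i j = φ (.inl i) := fun i ↦ by
      simpa [L] using hφ (.inl i)
    choose f hf using hA
    have hB : ∀ t, ∃ i : Fin m, Nat.pair i (f i) = φ (.inr (f, t)) := fun t ↦ by
      simpa [L] using hφ (.inr (f, t))
    choose g hg using hB
    obtain ⟨i, hi⟩ := Fintype.exists_lt_card_fiber_of_mul_lt_card g (n := 2) (by simp)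
    obtain ⟨a, ha, b, hb, c, hc, hab, hac, hbc⟩ := two_lt_card.1 hi
    have hcol : ∀ t ∈ ({t | g t = i} : Finset _), φ (.inr (f, t)) = φ (.inl i) := by
      intro t ht
      rw [← hg t, ← hf i, (mem_filter.1 ht).2]
    have := (hlin (φ (.inl i))).2 ⟨.inl i, rfl⟩ ⟨.inr (f, a), hcol a ha⟩ ⟨.inr (f, b), hcol b hb⟩
      ⟨.inr (f, c), hcol c hc⟩ (by simp) (by simp) (by simp)
    simp [hab, hac, hbc] at this

theorem SimpleGraph.IsStarForest.of_iso {V W : Type*} {G : SimpleGraph V} {H : SimpleGraph W}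
    (e : G ≃g H) (h : H.IsStarForest) : G.IsStarForest := by
  refine ⟨e.isAcyclic_iff.2 h.1, ?_⟩
  rintro u v huv ⟨⟨a, b, hab, hua, hub⟩, ⟨a', b', hab', hva, hvb⟩⟩
  exact h.2 (e u) (e v) (e.map_adj_iff.2 huv)
    ⟨⟨e a, e b, e.injective.ne hab, e.map_adj_iff.2 hua, e.map_adj_iff.2 hub⟩,
      ⟨e a', e b', e.injective.ne hab', e.map_adj_iff.2 hva, e.map_adj_iff.2 hvb⟩⟩

theorem SimpleGraph.IsLinearForest.of_iso {V W : Type*} {G : SimpleGraph V} {H : SimpleGraph W}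
    (e : G ≃g H) (h : H.IsLinearForest) : G.IsLinearForest := by
  refine ⟨e.isAcyclic_iff.2 h.1, fun v a b c ha hb hc ↦ ?_⟩
  simpa using h.2 (e v) (e a) (e b) (e c) (e.map_adj_iff.2 ha) (e.map_adj_iff.2 hb)
    (e.map_adj_iff.2 hc)

/-- An isomorphism of graphs restricts to the subgraphs induced by a set and its preimage. -/
def SimpleGraph.Iso.inducePreimage {V W : Type*} {G : SimpleGraph V} {H : SimpleGraph W}
    (e : G ≃g H) (s : Set W) : G.induce (e ⁻¹' s) ≃g H.induce s where
  toEquiv := e.toEquiv.subtypeEquiv fun _ ↦ Iff.rfl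
  map_rel_iff' := e.map_adj_iff

/-- For every `k ≥ 2` there is a finite graph `G` that is star-forest
`k`-choosable, yet some list assignment with all lists of size `k(k+1) - 1` admits no
colouring whose colour classes all induce linear forests. -/
theorem exists_graph_starChoosable_not_linearForestChoosable (k : ℕ) (hk : 2 ≤ k) :
    ∃ (N : ℕ) (G : SimpleGraph (Fin N)),
      (∀ L : Fin N → Finset ℕ, (∀ v, k ≤ (L v).card) →
        ∃ φ : Fin N → ℕ, (∀ v, φ v ∈ L v) ∧
          ∀ c : ℕ, (G.induce {v | φ v = c}).IsStarForest) ∧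
      (∃ L : Fin N → Finset ℕ, (∀ v, (L v).card = k * (k + 1) - 1) ∧
        ¬ ∃ φ : Fin N → ℕ, (∀ v, φ v ∈ L v) ∧
            ∀ c : ℕ, (G.induce {v | φ v = c}).IsLinearForest) := by
  set m := k * (k + 1) - 1 with hm
  let H := completeBipartiteGraph (Fin m) ((Fin m → Fin m) × Fin (m * 2 + 1))
  let e := Fintype.equivFin (Fin m ⊕ (Fin m → Fin m) × Fin (m * 2 + 1))
  let E : H.comap e.symm ≃g H := SimpleGraph.Iso.comap e.symm H
  refine ⟨_, H.comap e.symm, fun L hL ↦ ?_, ?_⟩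
  · obtain ⟨φ, hφ, hstar⟩ :=
      SimpleGraph.exists_starForest_listColoring_completeBipartiteGraph (L := L ∘ e)
        (by omega : 0 < k) (by simp [hm]) fun v ↦ hL (e v)
    refine ⟨φ ∘ e.symm, fun v ↦ by simpa using hφ (e.symm v), fun c ↦ ?_⟩
    exact (hstar c).of_iso (E.inducePreimage {v | φ v = c})
  · obtain ⟨L, hL, hno⟩ := SimpleGraph.exists_lists_no_linearForest_completeBipartiteGraph m
    refine ⟨L ∘ e.symm, fun v ↦ hL _, ?_⟩
    rintro ⟨φ, hφ, hlin⟩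
    refine hno ⟨φ ∘ e, fun v ↦ by simpa using hφ (e v), fun c ↦ ?_⟩
    exact (hlin c).of_iso (E.symm.inducePreimage {v | φ v = c})
end

section
/- Let k, k' ≥ 1 be integers and let G be a finite simple graph whose vertex set can be partitioned into t sets such that, for each set, every connected component of the subgraph of G induced on that set has at most k' vertices. Then the vertex set of G can be partitioned into ⌈k'/k⌉·t sets such that, for each set, every connected component of the induced subgraph has at most k vertices. That is, χ_{G_k}(G) ≤ ⌈k'/k⌉·χ_{G_{k'}}(G). -/
/-- The spanning subgraph of `G` whose edges are the monochromatic edges of `f`. -/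
def SimpleGraph.monochromatic {V α : Type*} (G : SimpleGraph V) (f : V → α) : SimpleGraph V where
  Adj u v := G.Adj u v ∧ f u = f v
  symm := ⟨fun _ _ h => ⟨h.1.symm, h.2.symm⟩⟩
  loopless := ⟨fun _ h => G.irrefl h.1⟩

theorem SimpleGraph.exists_reachable_induce_of_monochromatic {V α : Type*} (G : SimpleGraph V)
    (f : V → α) {v w : V} (h : (G.monochromatic f).Reachable v w) :
    ∃ hw : f w = f v, (G.induce {x | f x = f v}).Reachable ⟨v, rfl⟩ ⟨w, hw⟩ := by
  rw [SimpleGraph.reachable_iff_reflTransGen] at h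
  induction h with
  | refl => exact ⟨rfl, SimpleGraph.Reachable.refl _⟩
  | tail _ hadj ih =>
    obtain ⟨hb, hr⟩ := ih
    refine ⟨hadj.2.symm.trans hb, hr.trans (SimpleGraph.Adj.reachable ?_)⟩
    exact hadj.1

/-- A finite type can be labelled by `Fin n` injectively on each class of a partition into
classes of size at most `n`. -/
theorem exists_fin_label_injOn_fibers {V β : Type*} [Finite V] (c : V → β) {n : ℕ} (hn : 1 ≤ n)
    (hc : ∀ v, {w | c w = c v}.ncard ≤ n) :
    ∃ l : V → Fin n, ∀ u v, c u = c v → l u = l v → u = v := by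
  have key : ∀ b, ∃ l : V → Fin n, Set.InjOn l {w | c w = b} := by
    intro b
    have : NeZero n := ⟨by omega⟩
    have hb : {w | c w = b}.ncard ≤ (Set.univ : Set (Fin n)).ncard := by
      rw [Set.ncard_univ, Nat.card_fin]
      rcases Set.eq_empty_or_nonempty {w | c w = b} with h | ⟨v, hv⟩
      · simp [h]
      · have hv' : c v = b := hv
        exact hv' ▸ hc v
    have hb' : {w | c w = b}.encard ≤ (Set.univ : Set (Fin n)).encard := by
      rw [← (Set.toFinite _).cast_ncard_eq, ← (Set.toFinite (Set.univ)).cast_ncard_eq]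
      exact_mod_cast hb
    obtain ⟨l, -, hl⟩ := (Set.toFinite {w | c w = b}).exists_injOn_of_encard_le hb'
    exact ⟨l, hl⟩
  choose l hl using key
  refine ⟨fun v => l (c v) v, fun u v huv h => hl (c v) huv rfl ?_⟩
  simpa only [huv] using h

/-- If the vertex set of a finite graph `G` partitions into `t` sets
each inducing a subgraph whose connected components have at most `k'` vertices, then it
partitions into `⌈k'/k⌉·t` sets each inducing a subgraph whose connected components
have at most `k` vertices, i.e. `χ_{G_k}(G) ≤ ⌈k'/k⌉·χ_{G_{k'}}(G)`. -/
theorem clustering_mono {V : Type*} [Fintype V]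
    (G : SimpleGraph V) (k k' t : ℕ) (hk : 1 ≤ k) (hk' : 1 ≤ k') (f : V → Fin t)
    (hf : ∀ i : Fin t, ∀ v : {x | f x = i},
      {w | (G.induce {x | f x = i}).Reachable v w}.ncard ≤ k') :
    ∃ g : V → Fin ((k' ⌈/⌉ k) * t),
      ∀ j : Fin ((k' ⌈/⌉ k) * t), ∀ v : {x | g x = j},
        {w | (G.induce {x | g x = j}).Reachable v w}.ncard ≤ k := by
  set H := G.monochromatic f
  obtain ⟨l, hl⟩ := exists_fin_label_injOn_fibers H.connectedComponentMk hk' fun v => by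
    refine le_trans ?_ (hf (f v) ⟨v, rfl⟩)
    rw [← Set.ncard_image_of_injective _ Subtype.val_injective]
    refine Set.ncard_le_ncard (fun w hw => ?_) (Set.toFinite _)
    obtain ⟨h, hr⟩ := G.exists_reachable_induce_of_monochromatic f
      (SimpleGraph.ConnectedComponent.exact hw).symm
    exact ⟨⟨w, h⟩, hr, rfl⟩
  have hlt : ∀ v, (l v : ℕ) / k < k' ⌈/⌉ k := fun v => by
    rw [Nat.div_lt_iff_lt_mul (by omega), mul_comm]
    exact (l v).isLt.trans_le (le_smul_ceilDiv (by omega : 0 < k))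
  let g : V → Fin ((k' ⌈/⌉ k) * t) := fun v => finProdFinEquiv (⟨(l v : ℕ) / k, hlt v⟩, f v)
  have hg : ∀ u v, g u = g v → (l u : ℕ) / k = (l v : ℕ) / k ∧ f u = f v := fun u v h => by
    simpa [g] using h
  refine ⟨g, fun j v => ?_⟩
  let φ : G.induce {x | g x = j} →g H :=
    ⟨Subtype.val, fun {a b} h => ⟨h, (hg a b (a.2.trans b.2.symm)).2⟩⟩
  refine le_of_le_of_eq (b := (Set.univ : Set (Fin k)).ncard) ?_
    (by rw [Set.ncard_univ, Nat.card_fin])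
  refine Set.ncard_le_ncard_of_injOn (fun w => (⟨(l w : ℕ) % k, Nat.mod_lt _ hk⟩ : Fin k))
    (fun _ _ => Set.mem_univ _) (fun a ha b hb hab => ?_) (Set.toFinite _)
  have hr : H.Reachable a b := (SimpleGraph.Reachable.symm ha |>.trans hb).map φ
  refine Subtype.ext (hl a b (SimpleGraph.ConnectedComponent.sound hr) (Fin.ext ?_))
  rw [← Nat.div_add_mod (l a : ℕ) k, ← Nat.div_add_mod (l b : ℕ) k,
    (hg a b (a.2.trans b.2.symm)).1, Fin.mk.inj hab]
end

section
/- Let k ≥ 1 be an integer, let A be a finite set, and let L : A → Finset ℕ satisfy |L(a)| = k for every a ∈ A. Then there exists a finite set C' of colours such that (k+1)·|C'| ≤ |{a ∈ A : L(a) ∩ C' ≠ ∅}|, and there exists an injective function ψ defined on A' = {a ∈ A : L(a) ∩ C' = ∅} with ψ(a) ∈ L(a) for every a ∈ A'. (In particular, the elements of A whose lists avoid C' can be given pairwise distinct colours from their own lists, all outside C'.) -/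
/-- If every set `t i` has at least `k ≥ 1` elements and every point lies in at most `k` of
them, then the family `t` has a system of distinct representatives. -/
theorem exists_injective_of_card_ge_of_degree_le {ι α : Type*} [Fintype ι] [DecidableEq α]
    {k : ℕ} (hk : 1 ≤ k) (t : ι → Finset α) (ht : ∀ i, k ≤ (t i).card)
    (hdeg : ∀ c, (Finset.univ.filter fun i => c ∈ t i).card ≤ k) :
    ∃ f : ι → α, Function.Injective f ∧ ∀ i, f i ∈ t i := by
  refine (Finset.all_card_le_biUnion_card_iff_exists_injective t).1 fun s => ?_
  refine Nat.le_of_mul_le_mul_right (Finset.card_mul_le_card_mul (fun i c => c ∈ t i)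
    (fun i hi => (ht i).trans (Finset.card_le_card fun c hc => ?_))
    (fun c _ => (Finset.card_le_card fun i hi => ?_).trans (hdeg c))) hk
  · exact Finset.mem_filter.2 ⟨Finset.mem_biUnion.2 ⟨i, hi, hc⟩, hc⟩
  · exact Finset.mem_filter.2 ⟨Finset.mem_univ i, (Finset.mem_filter.1 hi).2⟩

/-- There is a set `C` of colours meeting at least `m * |C|` of the lists such that every colour
lies in fewer than `m` of the lists avoiding `C`. -/
theorem exists_heavy_finset_of_degree_lt {A α : Type*} [Fintype A] [DecidableEq α]
    {m : ℕ} (hm : 1 ≤ m) (L : A → Finset α) :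
    ∃ C : Finset α, m * C.card ≤ (Finset.univ.filter fun a => (L a ∩ C).Nonempty).card ∧
      ∀ c, (Finset.univ.filter fun a => L a ∩ C = ∅ ∧ c ∈ L a).card < m := by
  classical
  obtain ⟨C, hC, hmax⟩ := Finset.exists_max_image
    ((Finset.univ.biUnion L).powerset.filter fun C =>
      m * C.card ≤ (Finset.univ.filter fun a => (L a ∩ C).Nonempty).card)
    Finset.card ⟨∅, by simp⟩
  rw [Finset.mem_filter, Finset.mem_powerset] at hC
  refine ⟨C, hC.2, fun c => ?_⟩
  by_contra! hc
  obtain ⟨a, ha⟩ := Finset.card_pos.1 (hm.trans hc)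
  obtain ⟨-, haC, hca⟩ := Finset.mem_filter.1 ha
  have hcC : c ∉ C := fun h => by
    simpa [haC] using Finset.mem_inter.2 ⟨hca, h⟩
  have hdisj : Disjoint (Finset.univ.filter fun a => (L a ∩ C).Nonempty)
      (Finset.univ.filter fun a => L a ∩ C = ∅ ∧ c ∈ L a) :=
    Finset.disjoint_filter.2 fun a _ h h' => h.ne_empty h'.1
  have hsub : (Finset.univ.filter fun a => (L a ∩ C).Nonempty) ∪
      (Finset.univ.filter fun a => L a ∩ C = ∅ ∧ c ∈ L a) ⊆
      Finset.univ.filter fun a => (L a ∩ insert c C).Nonempty := by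
    refine Finset.union_subset (fun b hb => ?_) (fun b hb => ?_)
    · exact Finset.mem_filter.2 ⟨Finset.mem_univ b, (Finset.mem_filter.1 hb).2.mono
        (Finset.inter_subset_inter_left (Finset.subset_insert c C))⟩
    · exact Finset.mem_filter.2 ⟨Finset.mem_univ b, c, Finset.mem_inter.2
        ⟨(Finset.mem_filter.1 hb).2.2, Finset.mem_insert_self c C⟩⟩
  have hle := Finset.card_le_card hsub
  rw [Finset.card_union_of_disjoint hdisj] at hle
  have hins := hmax (insert c C) (Finset.mem_filter.2 ⟨Finset.mem_powerset.2
    (Finset.insert_subset (Finset.mem_biUnion.2 ⟨a, Finset.mem_univ a, hca⟩) hC.1), by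
      rw [Finset.card_insert_of_notMem hcC, mul_add, mul_one]
      exact (Nat.add_le_add hC.2 hc).trans hle⟩)
  rw [Finset.card_insert_of_notMem hcC] at hins
  omega

/-- Given `k`-element lists `L a ⊆ ℕ` on a finite set `A`, there is a
"heavy" colour set `C'` with `(k+1)·|C'| ≤ |{a : L(a) ∩ C' ≠ ∅}|`, such that the
elements whose lists avoid `C'` can be given pairwise distinct colours from their own
lists. -/
theorem exists_heavy_colourSet_and_system_of_distinct_representatives
    {A : Type*} [Fintype A] (k : ℕ) (hk : 1 ≤ k)
    (L : A → Finset ℕ) (hL : ∀ a, (L a).card = k) :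
    ∃ C' : Finset ℕ,
      (k + 1) * C'.card ≤ (Finset.univ.filter fun a => (L a ∩ C').Nonempty).card ∧
      ∃ ψ : A → ℕ, (∀ a, L a ∩ C' = ∅ → ψ a ∈ L a) ∧
        Set.InjOn ψ {a | L a ∩ C' = ∅} := by
  classical
  obtain ⟨C, hC, hdeg⟩ := exists_heavy_finset_of_degree_lt (Nat.le_add_left 1 k) L
  obtain ⟨f, hf, hfL⟩ := exists_injective_of_card_ge_of_degree_le hk
    (fun a : {a // L a ∩ C = ∅} => L a) (fun a => (hL a).ge) fun c => by
      refine le_trans ?_ (Nat.le_of_lt_succ (hdeg c))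
      refine Finset.card_le_card_of_injOn Subtype.val (fun a ha => ?_)
        Subtype.val_injective.injOn
      simpa [a.2] using ha
  refine ⟨C, hC, fun a => if h : L a ∩ C = ∅ then f ⟨a, h⟩ else 0, fun a ha => ?_,
    fun a ha b hb hab => ?_⟩
  · simpa [ha] using hfL ⟨a, ha⟩
  · rw [Set.mem_ofPred_eq] at ha hb
    simp only [ha, hb, dif_pos] at hab
    exact congrArg Subtype.val (hf hab)
end
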